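/- arXiv:2202.00942 — 3 statements merged into one kernel-verified Lean document; each statement's English description precedes it below -/
import Mathlib

section
/- Fix real constants p and q, and for λ ∈ ℝ define Ψ_λ : (0,∞) → ℝ by Ψ_λ(t) = t^(1−λ)/(1−λ) if λ ≠ 1 and Ψ_λ(t) = ln t if λ = 1. Let Ω = (0,∞) × (0,∞), let g(x,y) = Ψ_p(x) + Ψ_q(y), and fix μ ∈ ℝ. Let P₁, P₂ ∈ Ω with g(P₁) = g(P₂) = μ, and let X* be a regular C¹ curve in Ω from P₁ to P₂ whose image is contained in the level set {(x,y) ∈ Ω : g(x,y) = μ}. Then for every C¹ curve X in Ω from P₁ to P₂ one has L_φ(X) ≥ L_φ(X*), where φ(x,y) = √(x^(2p) + y^(2q)). That is, level curves of Ψ_p(x) + Ψ_q(y) are weighted length-minimizers for the density √(x^(2p) + y^(2q)). -/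
open Set

/-- Euclidean norm of a vector in `ℝ × ℝ`. -/
noncomputable def elen (v : ℝ × ℝ) : ℝ := Real.sqrt (v.1 ^ 2 + v.2 ^ 2)

/-- Euclidean dot product on `ℝ × ℝ`. -/
def dotp (v w : ℝ × ℝ) : ℝ := v.1 * w.1 + v.2 * w.2

/-- The gradient `(u_x, u_y)` of `u : ℝ × ℝ → ℝ` at a point. -/
noncomputable def grad (u : ℝ × ℝ → ℝ) (p : ℝ × ℝ) : ℝ × ℝ :=
  (fderiv ℝ u p (1, 0), fderiv ℝ u p (0, 1))

/-- A C¹ curve in `Ω` from `P₁` to `P₂`, parametrized on `[0,1]`. -/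
def IsC1CurveIn (Ω : Set (ℝ × ℝ)) (P₁ P₂ : ℝ × ℝ) (X : ℝ → ℝ × ℝ) : Prop :=
  ContDiffOn ℝ 1 X (Icc 0 1) ∧ (∀ t ∈ Icc (0:ℝ) 1, X t ∈ Ω) ∧ X 0 = P₁ ∧ X 1 = P₂

/-- Regularity: nonvanishing velocity on `[0,1]`. -/
def IsRegularCurve (X : ℝ → ℝ × ℝ) : Prop :=
  ∀ t ∈ Icc (0:ℝ) 1, derivWithin X (Icc 0 1) t ≠ 0

/-- Weighted length `∫₀¹ φ(X(t)) ‖X'(t)‖ dt` with respect to a density `φ`. -/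
noncomputable def wLen (φ : ℝ × ℝ → ℝ) (X : ℝ → ℝ × ℝ) : ℝ :=
  ∫ t in (0:ℝ)..1, φ (X t) * elen (derivWithin X (Icc 0 1) t)

/-- `Ψ_λ(t) = t^(1−λ)/(1−λ)` if `λ ≠ 1`, and `ln t` if `λ = 1`. -/
noncomputable def Psi (l : ℝ) (t : ℝ) : ℝ :=
  if l = 1 then Real.log t else t ^ (1 - l) / (1 - l)

lemma Psi_hasDerivAt (l t : ℝ) (ht : 0 < t) : HasDerivAt (Psi l) (t ^ (-l)) t := by
  by_cases h : l = 1
  · have : Psi l = Real.log := by funext s; simp [Psi, h]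
    rw [this, h, Real.rpow_neg_one]
    exact Real.hasDerivAt_log ht.ne'
  · have : Psi l = fun s => s ^ (1 - l) / (1 - l) := by funext s; simp [Psi, h]
    rw [this]
    have h1 : (1 - l) ≠ 0 := fun h' => h (by linarith)
    have := (Real.hasDerivAt_rpow_const (x := t) (p := 1 - l) (Or.inl ht.ne')).div_const (1 - l)
    rw [mul_div_cancel_left₀ _ h1, show 1 - l - 1 = -l by ring] at this
    exact this

lemma curve_deriv {P₁ P₂ : ℝ × ℝ} {X : ℝ → ℝ × ℝ}
    (hX : IsC1CurveIn (Ioi (0:ℝ) ×ˢ Ioi (0:ℝ)) P₁ P₂ X) (t : ℝ) (ht : t ∈ Icc (0:ℝ) 1) :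
    HasDerivWithinAt (fun s => (X s).1) (derivWithin X (Icc 0 1) t).1 (Icc 0 1) t ∧
    HasDerivWithinAt (fun s => (X s).2) (derivWithin X (Icc 0 1) t).2 (Icc 0 1) t := by
  have h : HasDerivWithinAt X (derivWithin X (Icc 0 1) t) (Icc 0 1) t :=
    ((hX.1.differentiableOn (by norm_num)) t ht).hasDerivWithinAt
  exact ⟨(ContinuousLinearMap.fst ℝ ℝ ℝ).hasFDerivAt.comp_hasDerivWithinAt t h,
    (ContinuousLinearMap.snd ℝ ℝ ℝ).hasFDerivAt.comp_hasDerivWithinAt t h⟩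

/-- The calibration form evaluated on the velocity. -/
noncomputable def calib (p q : ℝ) (X : ℝ → ℝ × ℝ) (t : ℝ) : ℝ :=
  (X t).1 ^ p * (derivWithin X (Icc 0 1) t).1 - (X t).2 ^ q * (derivWithin X (Icc 0 1) t).2

lemma curve_cont {P₁ P₂ : ℝ × ℝ} {X : ℝ → ℝ × ℝ}
    (hX : IsC1CurveIn (Ioi (0:ℝ) ×ˢ Ioi (0:ℝ)) P₁ P₂ X) (r s : ℝ) :
    ContinuousOn (fun t => (X t).1 ^ r) (Icc 0 1) ∧
    ContinuousOn (fun t => (X t).2 ^ s) (Icc 0 1) ∧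
    ContinuousOn (derivWithin X (Icc 0 1)) (Icc 0 1) := by
  have hc := hX.1.continuousOn
  refine ⟨?_, ?_, hX.1.continuousOn_derivWithin (uniqueDiffOn_Icc one_pos) le_rfl⟩
  · exact hc.fst.rpow_const fun t ht => Or.inl (ne_of_gt (hX.2.1 t ht).1)
  · exact hc.snd.rpow_const fun t ht => Or.inl (ne_of_gt (hX.2.1 t ht).2)

lemma calib_cont {P₁ P₂ : ℝ × ℝ} {X : ℝ → ℝ × ℝ}
    (hX : IsC1CurveIn (Ioi (0:ℝ) ×ˢ Ioi (0:ℝ)) P₁ P₂ X) (p q : ℝ) :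
    ContinuousOn (calib p q X) (Icc 0 1) := by
  obtain ⟨h1, h2, h3⟩ := curve_cont hX p q
  exact (h1.mul h3.fst).sub (h2.mul h3.snd)

lemma calib_integral {P₁ P₂ : ℝ × ℝ} {X : ℝ → ℝ × ℝ}
    (hX : IsC1CurveIn (Ioi (0:ℝ) ×ˢ Ioi (0:ℝ)) P₁ P₂ X) (p q : ℝ) :
    ∫ t in (0:ℝ)..1, calib p q X t =
      (Psi (-p) P₂.1 - Psi (-q) P₂.2) - (Psi (-p) P₁.1 - Psi (-q) P₁.2) := by
  have hd : ∀ t ∈ Icc (0:ℝ) 1, HasDerivWithinAt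
      (fun s => Psi (-p) (X s).1 - Psi (-q) (X s).2) (calib p q X t) (Icc 0 1) t := by
    intro t ht
    obtain ⟨h1, h2⟩ := curve_deriv hX t ht
    have a := (Psi_hasDerivAt (-p) _ (hX.2.1 t ht).1).comp_hasDerivWithinAt t h1
    have b := (Psi_hasDerivAt (-q) _ (hX.2.1 t ht).2).comp_hasDerivWithinAt t h2
    rw [neg_neg] at a b
    exact a.sub b
  have := intervalIntegral.integral_eq_sub_of_hasDerivAt_of_le zero_le_one
    (f := fun s => Psi (-p) (X s).1 - Psi (-q) (X s).2) (f' := calib p q X)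
    (fun t ht => (hd t ht).continuousWithinAt)
    (fun t ht => (hd t (Ioo_subset_Icc_self ht)).hasDerivAt (Icc_mem_nhds ht.1 ht.2))
    (by
      apply ContinuousOn.intervalIntegrable
      rw [uIcc_of_le zero_le_one]
      exact calib_cont hX p q)
  rw [this]
  simp only [hX.2.2.1, hX.2.2.2]

lemma dens_eq {P₁ P₂ : ℝ × ℝ} {X : ℝ → ℝ × ℝ}
    (hX : IsC1CurveIn (Ioi (0:ℝ) ×ˢ Ioi (0:ℝ)) P₁ P₂ X) (p q t : ℝ) (ht : t ∈ Icc (0:ℝ) 1) :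
    Real.sqrt ((X t).1 ^ (2 * p) + (X t).2 ^ (2 * q)) * elen (derivWithin X (Icc 0 1) t) =
    Real.sqrt (calib p q X t ^ 2 + ((X t).1 ^ p * (derivWithin X (Icc 0 1) t).2
      + (X t).2 ^ q * (derivWithin X (Icc 0 1) t).1) ^ 2) := by
  have h1 : 0 < (X t).1 := (hX.2.1 t ht).1
  have h2 : 0 < (X t).2 := (hX.2.1 t ht).2
  rw [elen, ← Real.sqrt_mul (by positivity)]
  congr 1
  rw [two_mul, two_mul, Real.rpow_add h1, Real.rpow_add h2, calib]
  ring

lemma level_eq {P₁ P₂ : ℝ × ℝ} {X : ℝ → ℝ × ℝ} (p q μ : ℝ)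
    (hX : IsC1CurveIn (Ioi (0:ℝ) ×ˢ Ioi (0:ℝ)) P₁ P₂ X)
    (hlevel : ∀ t ∈ Icc (0:ℝ) 1, Psi p (X t).1 + Psi q (X t).2 = μ)
    (t : ℝ) (ht : t ∈ Icc (0:ℝ) 1) :
    (X t).1 ^ p * (derivWithin X (Icc 0 1) t).2
      + (X t).2 ^ q * (derivWithin X (Icc 0 1) t).1 = 0 := by
  have h1 : 0 < (X t).1 := (hX.2.1 t ht).1
  have h2 : 0 < (X t).2 := (hX.2.1 t ht).2
  obtain ⟨d1, d2⟩ := curve_deriv hX t ht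
  have a := (Psi_hasDerivAt p _ h1).comp_hasDerivWithinAt t d1
  have b := (Psi_hasDerivAt q _ h2).comp_hasDerivWithinAt t d2
  have c := a.add b
  have c' : HasDerivWithinAt (fun _ : ℝ => μ) _ (Icc 0 1) t :=
    c.congr (fun s hs => (hlevel s hs).symm) (hlevel t ht).symm
  have e := (uniqueDiffOn_Icc (zero_lt_one (α := ℝ)) t ht).eq_deriv _ c'
    (hasDerivWithinAt_const t _ μ)
  rw [Real.rpow_neg h1.le, Real.rpow_neg h2.le] at e
  have := Real.rpow_pos_of_pos h1 p
  have := Real.rpow_pos_of_pos h2 q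
  field_simp at e
  linarith

/-- level curves of `Ψ_p(x) + Ψ_q(y)` in the open quadrant are
weighted length-minimizers for the density `√(x^(2p) + y^(2q))`. -/
theorem statement6 (p q μ : ℝ) (P₁ P₂ : ℝ × ℝ)
    (hP₁ : P₁ ∈ Ioi (0:ℝ) ×ˢ Ioi (0:ℝ)) (hP₁' : Psi p P₁.1 + Psi q P₁.2 = μ)
    (hP₂ : P₂ ∈ Ioi (0:ℝ) ×ˢ Ioi (0:ℝ)) (hP₂' : Psi p P₂.1 + Psi q P₂.2 = μ)
    (Xstar : ℝ → ℝ × ℝ)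
    (hXstar : IsC1CurveIn (Ioi (0:ℝ) ×ˢ Ioi (0:ℝ)) P₁ P₂ Xstar)
    (hreg : IsRegularCurve Xstar)
    (hlevel : ∀ t ∈ Icc (0:ℝ) 1, Psi p (Xstar t).1 + Psi q (Xstar t).2 = μ)
    (X : ℝ → ℝ × ℝ) (hX : IsC1CurveIn (Ioi (0:ℝ) ×ˢ Ioi (0:ℝ)) P₁ P₂ X) :
    wLen (fun w => Real.sqrt (w.1 ^ (2 * p) + w.2 ^ (2 * q))) X
      ≥ wLen (fun w => Real.sqrt (w.1 ^ (2 * p) + w.2 ^ (2 * q))) Xstar := by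
  have habs : wLen (fun w => Real.sqrt (w.1 ^ (2 * p) + w.2 ^ (2 * q))) Xstar
      = ∫ t in (0:ℝ)..1, |calib p q Xstar t| := by
    unfold wLen
    apply intervalIntegral.integral_congr
    intro t ht
    rw [uIcc_of_le zero_le_one] at ht
    simp only
    rw [dens_eq hXstar p q t ht, level_eq p q μ hXstar hlevel t ht]
    simp [Real.sqrt_sq_eq_abs]
  have hne : ∀ t ∈ Icc (0:ℝ) 1, calib p q Xstar t ≠ 0 := by
    intro t ht h0
    have hl := level_eq p q μ hXstar hlevel t ht
    have h1 := Real.rpow_pos_of_pos (hXstar.2.1 t ht).1 p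
    have h2 := Real.rpow_pos_of_pos (hXstar.2.1 t ht).2 q
    apply hreg t ht
    unfold calib at h0
    set a := (Xstar t).1 ^ p
    set b := (Xstar t).2 ^ q
    set v := derivWithin Xstar (Icc 0 1) t
    have hab : a ^ 2 + b ^ 2 ≠ 0 := by positivity
    have e1 : (a ^ 2 + b ^ 2) * v.1 = 0 := by linear_combination a * h0 + b * hl
    have e2 : (a ^ 2 + b ^ 2) * v.2 = 0 := by linear_combination a * hl - b * h0
    exact Prod.ext ((mul_eq_zero.1 e1).resolve_left hab) ((mul_eq_zero.1 e2).resolve_left hab)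
  have hsign : (∀ t ∈ Icc (0:ℝ) 1, 0 ≤ calib p q Xstar t) ∨
      (∀ t ∈ Icc (0:ℝ) 1, calib p q Xstar t ≤ 0) := by
    by_contra! hcon
    obtain ⟨⟨s, hs, hs'⟩, ⟨t, ht, ht'⟩⟩ := hcon
    obtain ⟨r, hr, hr'⟩ := isPreconnected_Icc.intermediate_value hs ht
      (calib_cont hXstar p q) ⟨hs'.le, ht'.le⟩
    exact hne r hr hr'
  have hstar : (∫ t in (0:ℝ)..1, |calib p q Xstar t|) = |∫ t in (0:ℝ)..1, calib p q Xstar t| := by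
    rcases hsign with h | h
    · rw [abs_of_nonneg (intervalIntegral.integral_nonneg zero_le_one h)]
      apply intervalIntegral.integral_congr
      intro t ht
      rw [uIcc_of_le zero_le_one] at ht
      exact abs_of_nonneg (h t ht)
    · have h' : (∫ t in (0:ℝ)..1, |calib p q Xstar t|) = - ∫ t in (0:ℝ)..1, calib p q Xstar t := by
        rw [← intervalIntegral.integral_neg]
        apply intervalIntegral.integral_congr
        intro t ht
        rw [uIcc_of_le zero_le_one] at ht
        exact abs_of_nonpos (h t ht)
      have h0 : 0 ≤ ∫ t in (0:ℝ)..1, |calib p q Xstar t| :=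
        intervalIntegral.integral_nonneg zero_le_one fun t _ => abs_nonneg _
      rw [abs_of_nonpos (by linarith), h']
  rw [habs, hstar, calib_integral hXstar, ← calib_integral hX p q, ge_iff_le]
  refine (intervalIntegral.abs_integral_le_integral_abs zero_le_one).trans ?_
  unfold wLen
  obtain ⟨c1, c2, c3⟩ := curve_cont hX (2 * p) (2 * q)
  apply intervalIntegral.integral_mono_on zero_le_one
  · apply ContinuousOn.intervalIntegrable
    rw [uIcc_of_le zero_le_one]
    exact (calib_cont hX p q).abs
  · apply ContinuousOn.intervalIntegrable
    rw [uIcc_of_le zero_le_one]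
    exact (c1.add c2).sqrt.mul ((c3.fst.pow 2).add (c3.snd.pow 2)).sqrt
  · intro t ht
    simp only
    rw [dens_eq hX p q t ht]
    exact Real.abs_le_sqrt (le_add_of_nonneg_right (sq_nonneg _))
end

section
/- Fix x₀ ∈ ℝ and let Ω = ℝ × (0, ∞) be the upper half-plane. Let C = {(x,y) ∈ Ω : x − x₀ + y²/2 = 0} (a half of the parabola with eccentricity 1 and focus on the x-axis). Let P₁, P₂ ∈ C and let X* be a regular C¹ curve in Ω from P₁ to P₂ whose image is contained in C. Then for every C¹ curve X in Ω from P₁ to P₂ one has L_φ(X) ≥ L_φ(X*), where φ(x,y) = √(1 + 1/y²). -/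
open Set

/-- The calibration derivative: velocity dotted with the gradient of `x - log y`. -/
noncomputable def calG (X : ℝ → ℝ × ℝ) (t : ℝ) : ℝ :=
  (derivWithin X (Icc 0 1) t).1 - (derivWithin X (Icc 0 1) t).2 / (X t).2

lemma contD {P₁ P₂ : ℝ × ℝ} {X : ℝ → ℝ × ℝ}
    (hX : IsC1CurveIn ((univ : Set ℝ) ×ˢ Ioi 0) P₁ P₂ X) :
    ContinuousOn (derivWithin X (Icc 0 1)) (Icc 0 1) :=
  hX.1.continuousOn_derivWithin (uniqueDiffOn_Icc one_pos) le_rfl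

lemma posY {P₁ P₂ : ℝ × ℝ} {X : ℝ → ℝ × ℝ}
    (hX : IsC1CurveIn ((univ : Set ℝ) ×ˢ Ioi 0) P₁ P₂ X) {t : ℝ} (ht : t ∈ Icc (0:ℝ) 1) :
    0 < (X t).2 := (hX.2.1 t ht).2

lemma contG {P₁ P₂ : ℝ × ℝ} {X : ℝ → ℝ × ℝ}
    (hX : IsC1CurveIn ((univ : Set ℝ) ×ˢ Ioi 0) P₁ P₂ X) :
    ContinuousOn (calG X) (Icc 0 1) := by
  have hD := contD hX
  have hc := hX.1.continuousOn
  exact hD.fst.sub (hD.snd.div hc.snd (fun t ht => (posY hX ht).ne'))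

lemma contF {P₁ P₂ : ℝ × ℝ} {X : ℝ → ℝ × ℝ}
    (hX : IsC1CurveIn ((univ : Set ℝ) ×ˢ Ioi 0) P₁ P₂ X) :
    ContinuousOn (fun t => Real.sqrt (1 + 1 / (X t).2 ^ 2) *
      elen (derivWithin X (Icc 0 1) t)) (Icc 0 1) := by
  have hD := contD hX
  have hc := hX.1.continuousOn
  unfold elen
  refine ContinuousOn.mul (ContinuousOn.sqrt ?_) (ContinuousOn.sqrt ?_)
  · exact continuousOn_const.add (continuousOn_const.div (hc.snd.pow 2)
      (fun t ht => pow_ne_zero 2 (posY hX ht).ne'))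
  · exact (hD.fst.pow 2).add (hD.snd.pow 2)

lemma derX {P₁ P₂ : ℝ × ℝ} {X : ℝ → ℝ × ℝ}
    (hX : IsC1CurveIn ((univ : Set ℝ) ×ˢ Ioi 0) P₁ P₂ X) {t : ℝ} (ht : t ∈ Icc (0:ℝ) 1) :
    HasDerivWithinAt X (derivWithin X (Icc 0 1) t) (Icc 0 1) t :=
  (hX.1.differentiableOn one_ne_zero t ht).hasDerivWithinAt

lemma intG {P₁ P₂ : ℝ × ℝ} {X : ℝ → ℝ × ℝ}
    (hX : IsC1CurveIn ((univ : Set ℝ) ×ˢ Ioi 0) P₁ P₂ X) :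
    ∫ t in (0:ℝ)..1, calG X t = (P₂.1 - Real.log P₂.2) - (P₁.1 - Real.log P₁.2) := by
  have hc := hX.1.continuousOn
  have := intervalIntegral.integral_eq_sub_of_hasDerivAt_of_le (a := 0) (b := 1)
    (f := fun t => (X t).1 - Real.log (X t).2) (f' := calG X) zero_le_one
    (hc.fst.sub (hc.snd.log (fun t ht => (posY hX ht).ne')))
    (fun t ht => by
      have hd := (derX hX (Ioo_subset_Icc_self ht)).hasDerivAt (Icc_mem_nhds ht.1 ht.2)
      have h1 : HasDerivAt (fun t => (X t).1) (derivWithin X (Icc 0 1) t).1 t := hd.fst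
      have h2 : HasDerivAt (fun t => (X t).2) (derivWithin X (Icc 0 1) t).2 t := hd.snd
      exact h1.sub (h2.log (posY hX (Ioo_subset_Icc_self ht)).ne'))
    ((contG hX).intervalIntegrable_of_Icc zero_le_one)
  rw [this, hX.2.2.1, hX.2.2.2]

lemma absG_le {X : ℝ → ℝ × ℝ} {t : ℝ} :
    |calG X t| ≤ Real.sqrt (1 + 1 / (X t).2 ^ 2) * elen (derivWithin X (Icc 0 1) t) := by
  unfold elen calG
  rw [← Real.sqrt_mul (by positivity)]
  apply Real.abs_le_sqrt
  generalize (derivWithin X (Icc 0 1) t).1 = a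
  generalize (derivWithin X (Icc 0 1) t).2 = b
  rw [div_eq_mul_inv, one_div, ← inv_pow]
  nlinarith [sq_nonneg (b + a * ((X t).2)⁻¹)]

/-- the half parabola `x − x₀ + y²/2 = 0` in the upper half-plane is
a weighted length-minimizer for the density `√(1 + 1/y²)`. -/
theorem statement14 (x₀ : ℝ) (P₁ P₂ : ℝ × ℝ)
    (hP₁ : P₁ ∈ (univ : Set ℝ) ×ˢ Ioi 0) (hP₁' : P₁.1 - x₀ + P₁.2 ^ 2 / 2 = 0)
    (hP₂ : P₂ ∈ (univ : Set ℝ) ×ˢ Ioi 0) (hP₂' : P₂.1 - x₀ + P₂.2 ^ 2 / 2 = 0)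
    (Xstar : ℝ → ℝ × ℝ)
    (hXstar : IsC1CurveIn ((univ : Set ℝ) ×ˢ Ioi 0) P₁ P₂ Xstar)
    (hreg : IsRegularCurve Xstar)
    (hlevel : ∀ t ∈ Icc (0:ℝ) 1, (Xstar t).1 - x₀ + (Xstar t).2 ^ 2 / 2 = 0)
    (X : ℝ → ℝ × ℝ) (hX : IsC1CurveIn ((univ : Set ℝ) ×ˢ Ioi 0) P₁ P₂ X) :
    wLen (fun p => Real.sqrt (1 + 1 / p.2 ^ 2)) X
      ≥ wLen (fun p => Real.sqrt (1 + 1 / p.2 ^ 2)) Xstar := by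
  have hlev : ∀ t ∈ Icc (0:ℝ) 1, (derivWithin Xstar (Icc 0 1) t).1
      = - ((Xstar t).2 * (derivWithin Xstar (Icc 0 1) t).2) := by
    intro t ht
    have hd := derX hXstar ht
    have h1 : HasDerivWithinAt (fun t => (Xstar t).1)
      (derivWithin Xstar (Icc 0 1) t).1 (Icc 0 1) t := hd.fst
    have h2 : HasDerivWithinAt (fun t => (Xstar t).2)
      (derivWithin Xstar (Icc 0 1) t).2 (Icc 0 1) t := hd.snd
    have h3 := (h1.sub_const x₀).add ((h2.pow 2).div_const 2)
    have h4 := (hasDerivWithinAt_const t (Icc (0:ℝ) 1) (0:ℝ)).congr_of_mem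
      (f₁ := (fun t => (Xstar t).1 - x₀) + fun t => ((fun t => (Xstar t).2) ^ 2) t / 2)
      (fun s hs => by simpa using hlevel s hs) ht
    have h5 := (uniqueDiffOn_Icc one_pos t ht).eq_deriv _ h3 h4
    norm_num at h5
    linarith
  have hne : ∀ t ∈ Icc (0:ℝ) 1, calG Xstar t ≠ 0 := by
    intro t ht h0
    have hy := posY hXstar ht
    have h1 := hlev t ht
    unfold calG at h0
    rw [h1] at h0
    have h2 : (derivWithin Xstar (Icc 0 1) t).2 * ((Xstar t).2 ^ 2 + 1) = 0 := by
      field_simp at h0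
      linarith
    have h3 : (derivWithin Xstar (Icc 0 1) t).2 = 0 := by
      rcases mul_eq_zero.mp h2 with h | h
      · exact h
      · nlinarith
    exact hreg t ht (Prod.ext (by rw [h1, h3]; simp) h3)
  have heq : ∀ t ∈ Icc (0:ℝ) 1, Real.sqrt (1 + 1 / (Xstar t).2 ^ 2) *
      elen (derivWithin Xstar (Icc 0 1) t) = |calG Xstar t| := by
    intro t ht
    have hy := posY hXstar ht
    unfold elen calG
    rw [← Real.sqrt_mul (by positivity), ← Real.sqrt_sq_eq_abs, hlev t ht]
    congr 1
    field_simp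
    ring
  have habs : ∫ t in (0:ℝ)..1, |calG Xstar t| = |∫ t in (0:ℝ)..1, calG Xstar t| := by
    have key : (∀ t ∈ Icc (0:ℝ) 1, 0 ≤ calG Xstar t) ∨ (∀ t ∈ Icc (0:ℝ) 1, calG Xstar t ≤ 0) := by
      by_contra! hcon
      obtain ⟨⟨a, ha, ha'⟩, ⟨b, hb, hb'⟩⟩ := hcon
      obtain ⟨c, hc, hc'⟩ := isPreconnected_Icc.intermediate_value ha hb (contG hXstar)
        ⟨ha'.le, hb'.le⟩
      exact hne c hc hc'
    rcases key with h | h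
    · rw [abs_of_nonneg (intervalIntegral.integral_nonneg zero_le_one h)]
      apply intervalIntegral.integral_congr
      intro t ht
      rw [uIcc_of_le zero_le_one] at ht
      exact abs_of_nonneg (h t ht)
    · have h' : ∫ t in (0:ℝ)..1, calG Xstar t ≤ 0 := by
        have h2 := intervalIntegral.integral_nonneg (f := fun t => - calG Xstar t)
          (μ := MeasureTheory.volume) zero_le_one (fun t ht => neg_nonneg.mpr (h t ht))
        rw [intervalIntegral.integral_neg] at h2
        linarith
      rw [abs_of_nonpos h', ← intervalIntegral.integral_neg]
      apply intervalIntegral.integral_congr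
      intro t ht
      rw [uIcc_of_le zero_le_one] at ht
      exact abs_of_nonpos (h t ht)
  have hstar : wLen (fun p => Real.sqrt (1 + 1 / p.2 ^ 2)) Xstar
      = ∫ t in (0:ℝ)..1, |calG Xstar t| := by
    unfold wLen
    apply intervalIntegral.integral_congr
    intro t ht
    rw [uIcc_of_le zero_le_one] at ht
    exact heq t ht
  rw [hstar, habs, intG hXstar, ← intG hX]
  refine (intervalIntegral.abs_integral_le_integral_abs zero_le_one).trans ?_
  unfold wLen
  exact intervalIntegral.integral_mono_on zero_le_one
    ((contG hX).abs.intervalIntegrable_of_Icc zero_le_one)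
    ((contF hX).intervalIntegrable_of_Icc zero_le_one) (fun t _ => absG_le)
end

section
/- Fix ε > 1 and x₀ ∈ ℝ, and let Ω = ℝ × (0, ∞) be the upper half-plane. Let C = {(x,y) ∈ Ω : (1 − ε²)·(x − x₀) − √(1 + (ε² − 1)·y²) = 0} (part of one branch of the hyperbola with eccentricity ε). Let P₁, P₂ ∈ C and let X* be a regular C¹ curve in Ω from P₁ to P₂ whose image is contained in C. Then for every C¹ curve X in Ω from P₁ to P₂ one has L_φ(X) ≥ L_φ(X*), where φ(x,y) = √(ε² + 1/y²). -/
open Set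

lemma aux_sq (k y : ℝ) (hk : 0 < k) : 0 < Real.sqrt (1 + k * y ^ 2) ∧
    Real.sqrt (1 + k * y ^ 2) ^ 2 = 1 + k * y ^ 2 :=
  ⟨Real.sqrt_pos.2 (by positivity), Real.sq_sqrt (by positivity)⟩

/-- components of the velocity -/
lemma aux_deriv {P₁ P₂ : ℝ × ℝ} {X : ℝ → ℝ × ℝ}
    (hX : IsC1CurveIn ((univ : Set ℝ) ×ˢ Ioi 0) P₁ P₂ X) (t : ℝ) (ht : t ∈ Icc (0:ℝ) 1) :
    HasDerivWithinAt (fun t => (X t).1) (derivWithin X (Icc 0 1) t).1 (Icc 0 1) t ∧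
    HasDerivWithinAt (fun t => (X t).2) (derivWithin X (Icc 0 1) t).2 (Icc 0 1) t := by
  have h := ((hX.1.differentiableOn one_ne_zero) t ht).hasDerivWithinAt
  have h' := h.hasFDerivWithinAt
  constructor
  · simpa using h'.fst.hasDerivWithinAt
  · simpa using h'.snd.hasDerivWithinAt

lemma aux_cont {P₁ P₂ : ℝ × ℝ} {X : ℝ → ℝ × ℝ}
    (hX : IsC1CurveIn ((univ : Set ℝ) ×ˢ Ioi 0) P₁ P₂ X) :
    ContinuousOn (fun t => derivWithin X (Icc 0 1) t) (Icc (0:ℝ) 1) :=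
  hX.1.continuousOn_derivWithin (uniqueDiffOn_Icc zero_lt_one) le_rfl

lemma aux_pos {P₁ P₂ : ℝ × ℝ} {X : ℝ → ℝ × ℝ}
    (hX : IsC1CurveIn ((univ : Set ℝ) ×ˢ Ioi 0) P₁ P₂ X) (t : ℝ) (ht : t ∈ Icc (0:ℝ) 1) :
    0 < (X t).2 := by
  have := hX.2.1 t ht
  simpa using this

lemma aux_hs (k y : ℝ) (hk : 0 < k) :
    HasDerivAt (fun y => Real.sqrt (1 + k * y ^ 2)) (k * y / Real.sqrt (1 + k * y ^ 2)) y := by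
  have h1 : HasDerivAt (fun y : ℝ => 1 + k * y ^ 2) (k * (2 * y)) y := by
    have := ((hasDerivAt_pow 2 y).const_mul k).const_add 1
    simpa using this
  have h2 := h1.sqrt (by positivity)
  convert h2 using 1
  have := (aux_sq k y hk).1
  field_simp

/-- The calibrating potential. -/
noncomputable def pot (k : ℝ) (p : ℝ × ℝ) : ℝ :=
  p.1 - (Real.sqrt (1 + k * p.2 ^ 2) + Real.log p.2 - Real.log (1 + Real.sqrt (1 + k * p.2 ^ 2)))

lemma aux_G (k y : ℝ) (hk : 0 < k) (hy : 0 < y) :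
    HasDerivAt (fun y => Real.sqrt (1 + k * y ^ 2) + Real.log y
      - Real.log (1 + Real.sqrt (1 + k * y ^ 2))) (Real.sqrt (1 + k * y ^ 2) / y) y := by
  have h1 := aux_hs k y hk
  obtain ⟨hs, hs2⟩ := aux_sq k y hk
  have h2 := (h1.add (Real.hasDerivAt_log hy.ne')).sub ((h1.const_add 1).log (by positivity))
  refine HasDerivAt.congr_deriv h2 ?_
  set s := Real.sqrt (1 + k * y ^ 2)
  have : 1 + s ≠ 0 := by positivity
  field_simp
  have : k * y ^ 2 = s ^ 2 - 1 := by linarith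
  linear_combination s * this

/-- derivative of the potential along the curve -/
noncomputable def vel (k : ℝ) (X : ℝ → ℝ × ℝ) (t : ℝ) : ℝ :=
  (derivWithin X (Icc 0 1) t).1
    - Real.sqrt (1 + k * (X t).2 ^ 2) / (X t).2 * (derivWithin X (Icc 0 1) t).2

lemma vel_cont {k : ℝ} {P₁ P₂ : ℝ × ℝ} {X : ℝ → ℝ × ℝ}
    (hX : IsC1CurveIn ((univ : Set ℝ) ×ˢ Ioi 0) P₁ P₂ X) :
    ContinuousOn (vel k X) (Icc (0:ℝ) 1) := by
  have h1 := aux_cont hX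
  have h2 := hX.1.continuousOn
  have h3 : ∀ t ∈ Icc (0:ℝ) 1, (X t).2 ≠ 0 := fun t ht => (aux_pos hX t ht).ne'
  have h4 : ContinuousOn (fun t => (X t).2) (Icc (0:ℝ) 1) := h2.snd
  exact h1.fst.sub (((continuousOn_const.add (continuousOn_const.mul (h4.pow 2))).sqrt.div h4 h3).mul
    h1.snd)

lemma vel_int {k : ℝ} (hk : 0 < k) {P₁ P₂ : ℝ × ℝ} {X : ℝ → ℝ × ℝ}
    (hX : IsC1CurveIn ((univ : Set ℝ) ×ˢ Ioi 0) P₁ P₂ X) :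
    ∫ t in (0:ℝ)..1, vel k X t = pot k P₂ - pot k P₁ := by
  have hd : ∀ t ∈ Icc (0:ℝ) 1,
      HasDerivWithinAt (fun t => pot k (X t)) (vel k X t) (Icc 0 1) t := by
    intro t ht
    obtain ⟨h1, h2⟩ := aux_deriv hX t ht
    have h3 := (aux_G k (X t).2 hk (aux_pos hX t ht)).comp_hasDerivWithinAt t h2
    exact h1.sub h3
  have := intervalIntegral.integral_eq_sub_of_hasDerivAt_of_le (f := fun t => pot k (X t))
    (f' := vel k X) zero_le_one (fun t ht => (hd t ht).continuousWithinAt)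
    (fun t ht => (hd t (Ioo_subset_Icc_self ht)).hasDerivAt (Icc_mem_nhds ht.1 ht.2))
    ((vel_cont hX).intervalIntegrable_of_Icc zero_le_one)
  rw [this, hX.2.2.1, hX.2.2.2]

lemma aux_phi (ε y : ℝ) (v : ℝ × ℝ) :
    Real.sqrt (ε ^ 2 + 1 / y ^ 2) * elen v
      = Real.sqrt ((ε ^ 2 + 1 / y ^ 2) * (v.1 ^ 2 + v.2 ^ 2)) := by
  rw [elen, Real.sqrt_mul (by positivity)]

lemma aux_ge (ε y : ℝ) (hε : 1 < ε) (hy : 0 < y) (v : ℝ × ℝ) :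
    |v.1 - Real.sqrt (1 + (ε ^ 2 - 1) * y ^ 2) / y * v.2| ≤
      Real.sqrt (ε ^ 2 + 1 / y ^ 2) * elen v := by
  rw [aux_phi]
  apply Real.abs_le_sqrt
  obtain ⟨hs, hs2⟩ := aux_sq (ε ^ 2 - 1) y (by nlinarith)
  set s := Real.sqrt (1 + (ε ^ 2 - 1) * y ^ 2)
  have : ε ^ 2 + 1 / y ^ 2 = 1 + (s / y) ^ 2 := by
    rw [div_pow, hs2]; field_simp; ring
  rw [this]
  nlinarith [sq_nonneg (s / y * v.1 + v.2)]

lemma aux_eq (ε y : ℝ) (hε : 1 < ε) (hy : 0 < y) (v : ℝ × ℝ)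
    (hv : v.1 = - (y / Real.sqrt (1 + (ε ^ 2 - 1) * y ^ 2) * v.2)) :
    Real.sqrt (ε ^ 2 + 1 / y ^ 2) * elen v =
    |v.1 - Real.sqrt (1 + (ε ^ 2 - 1) * y ^ 2) / y * v.2| := by
  rw [aux_phi, ← Real.sqrt_sq_eq_abs]
  obtain ⟨hs, hs2⟩ := aux_sq (ε ^ 2 - 1) y (by nlinarith)
  set s := Real.sqrt (1 + (ε ^ 2 - 1) * y ^ 2)
  have : ε ^ 2 + 1 / y ^ 2 = 1 + (s / y) ^ 2 := by
    rw [div_pow, hs2]; field_simp; ring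
  rw [this, hv]
  congr 1
  field_simp
  ring

lemma phi_integrable (ε : ℝ) {P₁ P₂ : ℝ × ℝ} {X : ℝ → ℝ × ℝ}
    (hX : IsC1CurveIn ((univ : Set ℝ) ×ˢ Ioi 0) P₁ P₂ X) :
    IntervalIntegrable (fun t => Real.sqrt (ε ^ 2 + 1 / (X t).2 ^ 2)
      * elen (derivWithin X (Icc 0 1) t)) MeasureTheory.volume 0 1 := by
  apply ContinuousOn.intervalIntegrable_of_Icc zero_le_one
  have h1 := aux_cont hX
  have h4 : ContinuousOn (fun t => (X t).2) (Icc (0:ℝ) 1) := hX.1.continuousOn.snd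
  have h3 : ∀ t ∈ Icc (0:ℝ) 1, (X t).2 ^ 2 ≠ 0 := fun t ht => pow_ne_zero _ (aux_pos hX t ht).ne'
  exact (continuousOn_const.add (continuousOn_const.div (h4.pow 2) h3)).sqrt.mul
    ((h1.fst.pow 2).add (h1.snd.pow 2)).sqrt

/-- the hyperbolic arc `(1 − ε²)(x − x₀) − √(1 + (ε² − 1)y²) = 0`
(eccentricity `ε > 1`) in the upper half-plane is a weighted length-minimizer
for the density `√(ε² + 1/y²)`. -/
theorem statement15 (ε x₀ : ℝ) (hε : 1 < ε) (P₁ P₂ : ℝ × ℝ)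
    (hP₁ : P₁ ∈ (univ : Set ℝ) ×ˢ Ioi 0)
    (hP₁' : (1 - ε ^ 2) * (P₁.1 - x₀) - Real.sqrt (1 + (ε ^ 2 - 1) * P₁.2 ^ 2) = 0)
    (hP₂ : P₂ ∈ (univ : Set ℝ) ×ˢ Ioi 0)
    (hP₂' : (1 - ε ^ 2) * (P₂.1 - x₀) - Real.sqrt (1 + (ε ^ 2 - 1) * P₂.2 ^ 2) = 0)
    (Xstar : ℝ → ℝ × ℝ)
    (hXstar : IsC1CurveIn ((univ : Set ℝ) ×ˢ Ioi 0) P₁ P₂ Xstar)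
    (hreg : IsRegularCurve Xstar)
    (hlevel : ∀ t ∈ Icc (0:ℝ) 1,
      (1 - ε ^ 2) * ((Xstar t).1 - x₀) - Real.sqrt (1 + (ε ^ 2 - 1) * (Xstar t).2 ^ 2) = 0)
    (X : ℝ → ℝ × ℝ) (hX : IsC1CurveIn ((univ : Set ℝ) ×ˢ Ioi 0) P₁ P₂ X) :
    wLen (fun p => Real.sqrt (ε ^ 2 + 1 / p.2 ^ 2)) X
      ≥ wLen (fun p => Real.sqrt (ε ^ 2 + 1 / p.2 ^ 2)) Xstar := by
  have hk : 0 < ε ^ 2 - 1 := by nlinarith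
  have hlow : |pot (ε ^ 2 - 1) P₂ - pot (ε ^ 2 - 1) P₁|
      ≤ wLen (fun p => Real.sqrt (ε ^ 2 + 1 / p.2 ^ 2)) X := by
    rw [← vel_int hk hX]
    refine (intervalIntegral.abs_integral_le_integral_abs zero_le_one).trans ?_
    refine intervalIntegral.integral_mono_on zero_le_one
      ((vel_cont hX).abs.intervalIntegrable_of_Icc zero_le_one) (phi_integrable ε hX) ?_
    intro t ht
    exact aux_ge ε _ hε (aux_pos hX t ht) _
  refine ge_iff_le.2 (le_trans (le_of_eq ?_) hlow)
  have hslope : ∀ t ∈ Icc (0:ℝ) 1, (derivWithin Xstar (Icc 0 1) t).1 =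
      - ((Xstar t).2 / Real.sqrt (1 + (ε ^ 2 - 1) * (Xstar t).2 ^ 2)
        * (derivWithin Xstar (Icc 0 1) t).2) := by
    intro t ht
    obtain ⟨h1, h2⟩ := aux_deriv hXstar t ht
    have h3 := ((h1.sub_const x₀).const_mul (1 - ε ^ 2)).sub
      ((aux_hs (ε ^ 2 - 1) _ hk).comp_hasDerivWithinAt t h2)
    have h4 : HasDerivWithinAt (fun _ : ℝ => (0:ℝ)) 0 (Icc 0 1) t := hasDerivWithinAt_const _ _ _
    have h5 := h4.congr (f₁ := fun t => (1 - ε ^ 2) * ((Xstar t).1 - x₀)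
      - Real.sqrt (1 + (ε ^ 2 - 1) * (Xstar t).2 ^ 2)) (fun s hs => hlevel s hs) (hlevel t ht)
    have h6 := (uniqueDiffOn_Icc zero_lt_one t ht).eq_deriv _ h3 h5
    have hs := (aux_sq (ε ^ 2 - 1) (Xstar t).2 hk).1
    have h7 : (ε ^ 2 - 1) * ((derivWithin Xstar (Icc 0 1) t).1 +
      ((Xstar t).2 / Real.sqrt (1 + (ε ^ 2 - 1) * (Xstar t).2 ^ 2)
        * (derivWithin Xstar (Icc 0 1) t).2)) = 0 := by
      linear_combination (-1) * h6
    have h8 := (mul_eq_zero.1 h7).resolve_left hk.ne'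
    linarith
  have hvel : ∀ t ∈ Icc (0:ℝ) 1, vel (ε ^ 2 - 1) Xstar t ≠ 0 := by
    intro t ht h0
    have hy := aux_pos hXstar t ht
    have hs := (aux_sq (ε ^ 2 - 1) (Xstar t).2 hk).1
    rw [vel, hslope t ht] at h0
    have h1 : ((Xstar t).2 / Real.sqrt (1 + (ε ^ 2 - 1) * (Xstar t).2 ^ 2)
      + Real.sqrt (1 + (ε ^ 2 - 1) * (Xstar t).2 ^ 2) / (Xstar t).2)
      * (derivWithin Xstar (Icc 0 1) t).2 = 0 := by linarith
    have h2 : (derivWithin Xstar (Icc 0 1) t).2 = 0 :=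
      (mul_eq_zero.1 h1).resolve_left (by positivity)
    apply hreg t ht
    ext
    · rw [hslope t ht, h2]; simp
    · rw [h2]; simp
  have hw : wLen (fun p => Real.sqrt (ε ^ 2 + 1 / p.2 ^ 2)) Xstar
      = ∫ t in (0:ℝ)..1, |vel (ε ^ 2 - 1) Xstar t| := by
    refine intervalIntegral.integral_congr ?_
    intro t ht
    rw [uIcc_of_le zero_le_one] at ht
    exact aux_eq ε _ hε (aux_pos hXstar t ht) _ (hslope t ht)
  rw [hw, ← vel_int hk hXstar]
  have hsign : (∀ t ∈ Icc (0:ℝ) 1, 0 ≤ vel (ε ^ 2 - 1) Xstar t) ∨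
      (∀ t ∈ Icc (0:ℝ) 1, vel (ε ^ 2 - 1) Xstar t ≤ 0) := by
    by_contra! hcon
    obtain ⟨⟨a, ha, ha'⟩, b, hb, hb'⟩ := hcon
    obtain ⟨c, hc, hc'⟩ := isPreconnected_Icc.intermediate_value ha hb (vel_cont hXstar)
      (⟨ha'.le, hb'.le⟩ : (0:ℝ) ∈ Icc _ _)
    exact hvel c hc hc'
  rcases hsign with h | h
  · rw [abs_of_nonneg (intervalIntegral.integral_nonneg zero_le_one h)]
    refine intervalIntegral.integral_congr fun t ht => ?_
    rw [uIcc_of_le zero_le_one] at ht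
    exact abs_of_nonneg (h t ht)
  · have h0 : 0 ≤ ∫ t in (0:ℝ)..1, -vel (ε ^ 2 - 1) Xstar t :=
      intervalIntegral.integral_nonneg zero_le_one fun t ht => neg_nonneg.2 (h t ht)
    rw [← abs_neg (∫ t in (0:ℝ)..1, vel (ε ^ 2 - 1) Xstar t), ← intervalIntegral.integral_neg,
      abs_of_nonneg h0]
    refine intervalIntegral.integral_congr fun t ht => ?_
    rw [uIcc_of_le zero_le_one] at ht
    exact abs_of_nonpos (h t ht)
end
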